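/- There exists a constant C > 0, depending only on C₀, such that the following holds for every N ≥ 1 and every multiplier m as in the context: for all ξ₁, …, ξ₆ ∈ ℝ with ξ₁ + ξ₂ + ξ₃ + ξ₄ + ξ₅ + ξ₆ = 0, one has |σ₄(ξ₁, ξ₂, ξ₃, ξ₄ + ξ₅ + ξ₆)| ≤ C · m²(μ) / ((N + |ξ₁|)(N + |ξ₂|)(N + |ξ₃|)(N + |ξ₄ + ξ₅ + ξ₆|)), where μ = min(|ξ₁|, |ξ₂|, |ξ₃|, |ξ₄ + ξ₅ + ξ₆|). -/

import Mathlib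

/-- `m` is the `I`-method multiplier at level `N` (with `s = -1/2`), with derivative
bounds of constant `C₀`. -/
def IsIMultiplier (N C₀ : ℝ) (m : ℝ → ℝ) : Prop :=
  ContDiff ℝ (⊤ : ℕ∞) m ∧ (∀ ξ, m (-ξ) = m ξ) ∧ (∀ ξ, m ξ ∈ Set.Icc (0:ℝ) 1) ∧
  (∀ a b : ℝ, 0 ≤ a → a ≤ b → m b ≤ m a) ∧
  (∀ ξ : ℝ, |ξ| ≤ N → m ξ = 1) ∧
  (∀ ξ : ℝ, 2 * N ≤ |ξ| → m ξ = (|ξ| / N) ^ (-(1/2) : ℝ)) ∧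
  (∀ ξ : ℝ, ξ ≠ 0 → |deriv (fun x => (m x)^2) ξ| ≤ C₀ * (m ξ)^2 / |ξ|) ∧
  (∀ ξ : ℝ, ξ ≠ 0 → |deriv (deriv (fun x => (m x)^2)) ξ| ≤ C₀ * (m ξ)^2 / ξ^2)

/-- The correction-term multiplier
`σ₄(ξ₁,ξ₂,ξ₃,ξ₄) = (m²(ξ₁)−m²(ξ₂)+m²(ξ₃)−m²(ξ₄))/(ξ₁⁴−ξ₂⁴+ξ₃⁴−ξ₄⁴)` (and `0` when
the denominator vanishes). -/
noncomputable def sigma4 (m : ℝ → ℝ) (a b c d : ℝ) : ℝ :=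
  if a^4 - b^4 + c^4 - d^4 = 0 then 0
  else ((m a)^2 - (m b)^2 + (m c)^2 - (m d)^2) / (a^4 - b^4 + c^4 - d^4)

/-- The mixed second difference of `f` is controlled by a bound on `f''` over a convex set
containing the four points. -/
lemma abs_second_difference_le {f : ℝ → ℝ} (hf : ContDiff ℝ 2 f) {S : Set ℝ} (hS : Convex ℝ S)
    {B : ℝ} (hB : ∀ x ∈ S, |deriv (deriv f) x| ≤ B) {a s t : ℝ} (h₀ : a ∈ S) (h₁ : a - s ∈ S)
    (h₂ : a - t ∈ S) (h₃ : a - s - t ∈ S) :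
    |(f a - f (a - t)) - (f (a - s) - f (a - s - t))| ≤ B * |t| * |s| := by
  have hd : Differentiable ℝ f := hf.differentiable (by norm_num)
  have hd' : Differentiable ℝ (deriv f) :=
    (ContDiff.deriv' (n := 1) (by simpa [one_add_one_eq_two] using hf)).differentiable
      (by norm_num)
  have hT : Convex ℝ (S ∩ (fun x => x - t) ⁻¹' S) := by
    refine hS.inter ?_
    simpa [sub_eq_add_neg] using hS.translate_preimage_left (-t)
  have hderiv : ∀ x, HasDerivAt (fun x => f x - f (x - t)) (deriv f x - deriv f (x - t)) x := by
    intro x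
    exact (hd x).hasDerivAt.sub ((hd (x - t)).hasDerivAt.comp_sub_const x t)
  have key := hT.norm_image_sub_le_of_norm_hasDerivWithin_le (C := B * |t|)
    (fun x _ => (hderiv x).hasDerivWithinAt) (fun x hx => by
      have := hS.norm_image_sub_le_of_norm_deriv_le (fun y _ => hd' y) hB hx.2 hx.1
      simpa using this) (x := a - s) (y := a) ⟨h₁, h₃⟩ ⟨h₀, h₂⟩
  simpa using key

namespace IsIMultiplier

variable {N C₀ : ℝ} {m : ℝ → ℝ}

lemma abs_arg (h : IsIMultiplier N C₀ m) (x : ℝ) : m |x| = m x := by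
  rcases abs_choice x with hx | hx <;> rw [hx]
  exact h.2.1 x

lemma sq_le_sq (h : IsIMultiplier N C₀ m) {μ x : ℝ} (hμ : 0 ≤ μ) (hx : μ ≤ |x|) :
    m x ^ 2 ≤ m μ ^ 2 := by
  rw [← h.abs_arg x]
  exact pow_le_pow_left₀ (h.2.2.1 _).1 (h.2.2.2.1 _ _ hμ hx) 2

lemma abs_deriv_sq_le (h : IsIMultiplier N C₀ m) (hN : 1 ≤ N) (hC₀ : 0 < C₀) {μ x : ℝ}
    (hμ : 0 ≤ μ) (hx : μ ≤ x) :
    |deriv (fun x => m x ^ 2) x| ≤ 2 * C₀ * m μ ^ 2 / (N + μ) := by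
  rcases lt_or_ge x N with hxN | hxN
  · have hev : (fun x => m x ^ 2) =ᶠ[nhds x] fun _ => (1 : ℝ) := by
      filter_upwards [Ioo_mem_nhds (show -N < x by linarith) hxN] with y hy
      rw [h.2.2.2.2.1 y (abs_le.2 ⟨hy.1.le, hy.2.le⟩), one_pow]
    rw [hev.deriv_eq, deriv_const, abs_zero]
    positivity
  · have hx0 : 0 < x := by linarith
    have hm := h.sq_le_sq hμ (hx.trans (le_abs_self x))
    refine (h.2.2.2.2.2.2.1 x hx0.ne').trans ?_
    rw [abs_of_pos hx0, div_le_div_iff₀ hx0 (by linarith)]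
    calc C₀ * m x ^ 2 * (N + μ) ≤ C₀ * m μ ^ 2 * (2 * x) := by
          gcongr
          linarith
      _ = 2 * C₀ * m μ ^ 2 * x := by ring

lemma contDiff_sq (h : IsIMultiplier N C₀ m) : ContDiff ℝ 2 (fun x => m x ^ 2) :=
  ContDiff.pow (by exact_mod_cast contDiff_infty.1 h.1 2) 2

lemma abs_sq_sub_sq_le (h : IsIMultiplier N C₀ m) (hN : 1 ≤ N) (hC₀ : 0 < C₀) {μ x y : ℝ}
    (hμ : 0 ≤ μ) (hx : μ ≤ |x|) (hy : μ ≤ |y|) :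
    |m x ^ 2 - m y ^ 2| ≤ 2 * C₀ * m μ ^ 2 / (N + μ) * |x + y| := by
  have hd := h.contDiff_sq.differentiable (by norm_num)
  have key := (convex_Ici μ).norm_image_sub_le_of_norm_deriv_le (fun z _ => hd z)
    (fun z hz => h.abs_deriv_sq_le hN hC₀ hμ hz) (x := |y|) (y := |x|) hy hx
  simp only [h.abs_arg, Real.norm_eq_abs] at key
  refine key.trans ?_
  have : |(|x| - |y|)| ≤ |x + y| := by
    simpa using abs_abs_sub_abs_le x (-y)
  gcongr

/-- Numerator bound when the frequency sum `a + b` is comparable to the largest frequency. -/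
lemma abs_alternating_sum_mul_le_of_large (h : IsIMultiplier N C₀ m) (hN : 1 ≤ N) (hC₀ : 0 < C₀)
    {μ M a b c d : ℝ} (hsum : a + b + c + d = 0) (hμ : 0 ≤ μ) (ha : μ ≤ |a|) (hb : μ ≤ |b|)
    (hc : μ ≤ |c|) (hd : μ ≤ |d|) {P : ℝ} (hP : P ≤ (2 * M) ^ 3 * (N + μ)) (hM : 0 < M)
    (hs : M ≤ 4 * |a + b|) :
    |m a ^ 2 - m b ^ 2 + m c ^ 2 - m d ^ 2| * P
      ≤ 128 * C₀ * m μ ^ 2 * (|a + b| * |a + d| * M ^ 2) := by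
  have h1 := h.abs_sq_sub_sq_le hN hC₀ hμ ha hd
  have h2 := h.abs_sq_sub_sq_le hN hC₀ hμ hc hb
  rw [show c + b = -(a + d) by linarith, abs_neg] at h2
  have h3 : |m a ^ 2 - m b ^ 2 + m c ^ 2 - m d ^ 2| ≤
      4 * C₀ * m μ ^ 2 / (N + μ) * |a + d| := by
    calc _ = |(m a ^ 2 - m d ^ 2) + (m c ^ 2 - m b ^ 2)| := by ring_nf
      _ ≤ _ := (abs_add_le _ _).trans (add_le_add h1 h2)
      _ = _ := by ring
  have hNμ : 0 < N + μ := by linarith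
  calc _ ≤ |m a ^ 2 - m b ^ 2 + m c ^ 2 - m d ^ 2| * ((2 * M) ^ 3 * (N + μ)) := by gcongr
    _ ≤ 4 * C₀ * m μ ^ 2 / (N + μ) * |a + d| * ((2 * M) ^ 3 * (N + μ)) := by gcongr
    _ = 32 * C₀ * m μ ^ 2 * |a + d| * M ^ 2 * M := by field_simp; ring
    _ ≤ 32 * C₀ * m μ ^ 2 * |a + d| * M ^ 2 * (4 * |a + b|) := by gcongr
    _ = _ := by ring

/-- Numerator bound when all four frequencies (up to sign) are clustered away from zero. -/
lemma abs_alternating_sum_mul_le_of_convex (h : IsIMultiplier N C₀ m) (hC₀ : 0 < C₀)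
    {μ M a b c d : ℝ} (hsum : a + b + c + d = 0) (hM : 0 < M) (hμM : M ≤ 2 * μ)
    {S : Set ℝ} (hS : Convex ℝ S) (hSμ : ∀ x ∈ S, μ ≤ |x|) (ha : a ∈ S) (hb : -b ∈ S)
    (hc : c ∈ S) (hd : -d ∈ S) {P : ℝ} (hP : P ≤ (2 * M) ^ 4) :
    |m a ^ 2 - m b ^ 2 + m c ^ 2 - m d ^ 2| * P
      ≤ 128 * C₀ * m μ ^ 2 * (|a + b| * |a + d| * M ^ 2) := by
  have hμ : 0 < μ := by linarith
  have hB : ∀ x ∈ S, |deriv (deriv fun x => m x ^ 2) x| ≤ 4 * C₀ * m μ ^ 2 / M ^ 2 := by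
    intro x hx
    have hx1 := hSμ x hx
    have hx0 : x ≠ 0 := abs_pos.1 (hμ.trans_le hx1)
    have hm := h.sq_le_sq hμ.le hx1
    have hMx : M ^ 2 ≤ 4 * x ^ 2 := by
      rw [← sq_abs x]
      nlinarith
    refine (h.2.2.2.2.2.2.2 x hx0).trans ?_
    rw [div_le_div_iff₀ (by positivity) (by positivity)]
    calc C₀ * m x ^ 2 * M ^ 2 ≤ C₀ * m μ ^ 2 * (4 * x ^ 2) := by gcongr
      _ = _ := by ring
  have key := abs_second_difference_le h.contDiff_sq hS hB (a := a) (s := a + b) (t := a + d)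
    ha (by convert hb using 1; ring) (by convert hd using 1; ring)
    (by convert hc using 1; linarith)
  rw [show a - (a + d) = -d by ring, show a - (a + b) = -b by ring,
    show -b - (a + d) = c by linarith, h.2.1, h.2.1] at key
  rw [show m a ^ 2 - m d ^ 2 - (m b ^ 2 - m c ^ 2) =
    m a ^ 2 - m b ^ 2 + m c ^ 2 - m d ^ 2 by ring] at key
  calc _ ≤ |m a ^ 2 - m b ^ 2 + m c ^ 2 - m d ^ 2| * (2 * M) ^ 4 := by gcongr
    _ ≤ 4 * C₀ * m μ ^ 2 / M ^ 2 * |a + d| * |a + b| * (2 * M) ^ 4 := by gcongr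
    _ = 64 * C₀ * m μ ^ 2 * (|a + b| * |a + d| * M ^ 2) := by field_simp; ring
    _ ≤ _ := by gcongr; norm_num

lemma abs_alternating_sum_mul_le (h : IsIMultiplier N C₀ m) (hN : 1 ≤ N) (hC₀ : 0 < C₀)
    {μ M a b c d : ℝ} (hsum : a + b + c + d = 0) (hμ : 0 ≤ μ) (ha : μ ≤ |a|) (hb : μ ≤ |b|)
    (hc : μ ≤ |c|) (hd : μ ≤ |d|) (hμ' : μ = |a| ∨ μ = |b| ∨ μ = |c| ∨ μ = |d|)
    (haM : |a| ≤ M) (hbM : |b| ≤ M) (hcM : |c| ≤ M) (hdM : |d| ≤ M)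
    (hM' : M = |a| ∨ M = |b| ∨ M = |c| ∨ M = |d|) :
    |m a ^ 2 - m b ^ 2 + m c ^ 2 - m d ^ 2| *
        ((N + |a|) * (N + |b|) * (N + |c|) * (N + |d|))
      ≤ 128 * C₀ * m μ ^ 2 * (|a + b| * |a + d| * M ^ 2) := by
  rcases le_or_gt M N with hMN | hMN
  · have hone : ∀ x, |x| ≤ M → m x = 1 := fun x hx => h.2.2.2.2.1 x (hx.trans hMN)
    rw [hone a haM, hone b hbM, hone c hcM, hone d hdM]
    norm_num
    positivity
  have hM : 0 < M := by linarith
  have hP : (N + |a|) * (N + |b|) * (N + |c|) * (N + |d|) ≤ (2 * M) ^ 3 * (N + μ) := by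
    have hA : N + |a| ≤ 2 * M := by linarith
    have hB : N + |b| ≤ 2 * M := by linarith
    have hC : N + |c| ≤ 2 * M := by linarith
    have hD : N + |d| ≤ 2 * M := by linarith
    rcases hμ' with e | e | e | e
    · calc _ = (N + |b|) * (N + |c|) * (N + |d|) * (N + μ) := by rw [e]; ring
        _ ≤ (2 * M) * (2 * M) * (2 * M) * (N + μ) := by gcongr
        _ = _ := by ring
    · calc _ = (N + |a|) * (N + |c|) * (N + |d|) * (N + μ) := by rw [e]; ring
        _ ≤ (2 * M) * (2 * M) * (2 * M) * (N + μ) := by gcongr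
        _ = _ := by ring
    · calc _ = (N + |a|) * (N + |b|) * (N + |d|) * (N + μ) := by rw [e]; ring
        _ ≤ (2 * M) * (2 * M) * (2 * M) * (N + μ) := by gcongr
        _ = _ := by ring
    · calc _ = (N + |a|) * (N + |b|) * (N + |c|) * (N + μ) := by rw [e]
        _ ≤ (2 * M) * (2 * M) * (2 * M) * (N + μ) := by gcongr
        _ = _ := by ring
  rcases le_or_gt M (4 * |a + b|) with hs | hs
  · exact h.abs_alternating_sum_mul_le_of_large hN hC₀ hsum hμ ha hb hc hd hP hM hs
  rcases le_or_gt M (4 * |a + d|) with ht | ht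
  · have := h.abs_alternating_sum_mul_le_of_large hN hC₀ (b := d) (d := b) (by linarith)
      hμ ha hd hc hb hP hM ht
    rw [show m a ^ 2 - m b ^ 2 + m c ^ 2 - m d ^ 2 = m a ^ 2 - m d ^ 2 + m c ^ 2 - m b ^ 2 by ring,
      mul_comm |a + b|]
    exact this
  have hP' : (N + |a|) * (N + |b|) * (N + |c|) * (N + |d|) ≤ (2 * M) ^ 4 := by
    refine hP.trans ?_
    rw [pow_succ (2 * M) 3]
    gcongr
    linarith
  have hs' : |4 * (a + b)| < M := by simpa [abs_mul] using hs
  have ht' : |4 * (a + d)| < M := by simpa [abs_mul] using ht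
  rw [abs_lt] at hs' ht'
  have hpos : (M ≤ 2 * a ∧ M ≤ 2 * -b ∧ M ≤ 2 * c ∧ M ≤ 2 * -d) ∨
      (M ≤ 2 * -a ∧ M ≤ 2 * b ∧ M ≤ 2 * -c ∧ M ≤ 2 * d) := by
    rcases hM' with e | e | e | e <;> rcases eq_or_eq_neg_of_abs_eq e.symm with e' | e' <;>
      first
      | (left; refine ⟨?_, ?_, ?_, ?_⟩ <;> linarith)
      | (right; refine ⟨?_, ?_, ?_, ?_⟩ <;> linarith)
  have hμM : M ≤ 2 * μ := by
    rcases hpos with ⟨h1, h2, h3, h4⟩ | ⟨h1, h2, h3, h4⟩ <;> rcases hμ' with e | e | e | e <;>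
      rw [e] <;>
      linarith [le_abs_self a, neg_le_abs a, le_abs_self b, neg_le_abs b, le_abs_self c,
        neg_le_abs c, le_abs_self d, neg_le_abs d]
  rcases hpos with ⟨h1, h2, h3, h4⟩ | ⟨h1, h2, h3, h4⟩
  · rw [abs_of_pos (show 0 < a by linarith)] at ha
    rw [abs_of_neg (show b < 0 by linarith)] at hb
    rw [abs_of_pos (show 0 < c by linarith)] at hc
    rw [abs_of_neg (show d < 0 by linarith)] at hd
    exact h.abs_alternating_sum_mul_le_of_convex hC₀ hsum hM hμM (convex_Ici μ)
      (fun x hx => (Set.mem_Ici.1 hx).trans (le_abs_self x)) ha hb hc hd hP'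
  · rw [abs_of_neg (show a < 0 by linarith)] at ha
    rw [abs_of_pos (show 0 < b by linarith)] at hb
    rw [abs_of_neg (show c < 0 by linarith)] at hc
    rw [abs_of_pos (show 0 < d by linarith)] at hd
    exact h.abs_alternating_sum_mul_le_of_convex hC₀ hsum hM hμM (convex_Iic (-μ))
      (fun x hx => (le_neg.1 (Set.mem_Iic.1 hx)).trans (neg_le_abs x))
      (Set.mem_Iic.2 (by linarith)) (Set.mem_Iic.2 (by linarith))
      (Set.mem_Iic.2 (by linarith)) (Set.mem_Iic.2 (by linarith)) hP'

end IsIMultiplier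

/-- The quartic resonance function factors on the hyperplane `a + b + c + d = 0`. -/
lemma quartic_resonance_eq {a b c d : ℝ} (hsum : a + b + c + d = 0) :
    a ^ 4 - b ^ 4 + c ^ 4 - d ^ 4 =
      (a + b) * (a + d) * (a ^ 2 + b ^ 2 + c ^ 2 + d ^ 2 + 2 * (a + c) ^ 2) := by
  obtain rfl : c = -(a + b + d) := by linarith
  ring

/-- Bound for the 6-linear multiplier `M₆(ξ₁,…,ξ₆) = i σ₄(ξ₁,ξ₂,ξ₃,ξ₄+ξ₅+ξ₆)`:
`|σ₄(ξ₁,ξ₂,ξ₃,ξ₄+ξ₅+ξ₆)| ≤ C m²(μ) / ((N+|ξ₁|)(N+|ξ₂|)(N+|ξ₃|)(N+|ξ₄+ξ₅+ξ₆|))`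
on the hyperplane `ξ₁+⋯+ξ₆ = 0`, where `μ = min(|ξ₁|,|ξ₂|,|ξ₃|,|ξ₄+ξ₅+ξ₆|)`. -/
theorem stmt_12 (C₀ : ℝ) (hC₀ : 0 < C₀) :
    ∃ C > (0:ℝ), ∀ N : ℝ, 1 ≤ N → ∀ m : ℝ → ℝ, IsIMultiplier N C₀ m →
      ∀ ξ₁ ξ₂ ξ₃ ξ₄ ξ₅ ξ₆ : ℝ, ξ₁ + ξ₂ + ξ₃ + ξ₄ + ξ₅ + ξ₆ = 0 →
        |sigma4 m ξ₁ ξ₂ ξ₃ (ξ₄ + ξ₅ + ξ₆)| ≤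
          C * (m (min (min |ξ₁| |ξ₂|) (min |ξ₃| |ξ₄ + ξ₅ + ξ₆|)))^2 /
            ((N + |ξ₁|) * (N + |ξ₂|) * (N + |ξ₃|) * (N + |ξ₄ + ξ₅ + ξ₆|)) := by
  refine ⟨128 * C₀, by positivity, ?_⟩
  intro N hN m h a b c ξ₄ ξ₅ ξ₆ hsum
  obtain ⟨d, hd⟩ : ∃ d, d = ξ₄ + ξ₅ + ξ₆ := ⟨_, rfl⟩
  rw [← hd]
  replace hsum : a + b + c + d = 0 := by linarith
  unfold sigma4
  split_ifs with h0
  · rw [abs_zero]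
    positivity
  set μ := min (min |a| |b|) (min |c| |d|) with hμ
  set M := max (max |a| |b|) (max |c| |d|) with hM
  have key := h.abs_alternating_sum_mul_le hN hC₀ hsum (μ := μ) (M := M) (by positivity)
    (by simp [hμ]) (by simp [hμ]) (by simp [hμ]) (by simp [hμ]) (by grind)
    (by simp [hM]) (by simp [hM]) (by simp [hM]) (by simp [hM]) (by grind)
  have hQ : M ^ 2 ≤ a ^ 2 + b ^ 2 + c ^ 2 + d ^ 2 + 2 * (a + c) ^ 2 := by
    have hMcases : M = |a| ∨ M = |b| ∨ M = |c| ∨ M = |d| := by grind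
    rcases hMcases with e | e | e | e <;> rw [e, sq_abs] <;>
      nlinarith [sq_nonneg a, sq_nonneg b, sq_nonneg c, sq_nonneg d, sq_nonneg (a + c)]
  rw [abs_div, div_le_div_iff₀ (abs_pos.2 h0) (by positivity), quartic_resonance_eq hsum,
    abs_mul, abs_mul, abs_of_nonneg ((sq_nonneg M).trans hQ)]
  refine key.trans ?_
  gcongr
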